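/- arXiv:1909.13870 — 5 statements merged into one kernel-verified Lean document; each statement's English description precedes it below -/
import Mathlib

section
/- Let M be a finite MDP with exogenous structure satisfying the three conditions of Theorem 1: (1) the reward depends only on the reduced state, R((n,x̃,x̄),a) = R̃((n,x̃),a); (2) the endogenous transition does not depend on the unmasked exogenous variables; (3) the masked and unmasked exogenous variables transition independently, so the full transition factorizes as P((n',x̃',x̄') | (n,x̃,x̄), a) = pN(n' | n, a, x̃) · pX̃(x̃' | x̃) · pX̄(x̄' | x̄). Then for any reduced policy π̃ : N × X̃ → A, the value function Ṽ_π̃ of π̃ in the reduced MDP agrees with the value function V_π̃ of the lifted policy in the full MDP: for every full state s = (n, x̃, x̄), Ṽ_π̃(n, x̃) = V_π̃(n, x̃, x̄). -/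
/-- Theorem 1 (value agreement): under the three exogeneity conditions,
the value function of a reduced policy in the reduced MDP agrees with
the value function of the lifted policy in the full MDP. -/
theorem reduced_value_eq_full_value
    {N Xt Xb A : Type} [Fintype N] [Fintype Xt] [Fintype Xb] [Fintype A]
    [Nonempty N] [Nonempty Xt] [Nonempty Xb] [Nonempty A]
    (pN : N → A → Xt → N → ℝ) (pXt : Xt → Xt → ℝ) (pXb : Xb → Xb → ℝ)
    (Rt : N × Xt → A → ℝ) (γ : ℝ)
    (hpN0 : ∀ n a xt n', 0 ≤ pN n a xt n')
    (hpN1 : ∀ n a xt, ∑ n', pN n a xt n' = 1)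
    (hpXt0 : ∀ xt xt', 0 ≤ pXt xt xt')
    (hpXt1 : ∀ xt, ∑ xt', pXt xt xt' = 1)
    (hpXb0 : ∀ xb xb', 0 ≤ pXb xb xb')
    (hpXb1 : ∀ xb, ∑ xb', pXb xb xb' = 1)
    (hγ0 : 0 ≤ γ) (hγ1 : γ < 1)
    (πt : N × Xt → A)
    (V : N × Xt × Xb → ℝ) (Vt : N × Xt → ℝ)
    (hV : ∀ n xt xb, V (n, xt, xb) =
      Rt (n, xt) (πt (n, xt)) +
        γ * ∑ n', ∑ xt', ∑ xb',
          pN n (πt (n, xt)) xt n' * pXt xt xt' * pXb xb xb' * V (n', xt', xb'))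
    (hVt : ∀ n xt, Vt (n, xt) =
      Rt (n, xt) (πt (n, xt)) +
        γ * ∑ n', ∑ xt', pN n (πt (n, xt)) xt n' * pXt xt xt' * Vt (n', xt')) :
    ∀ n xt xb, Vt (n, xt) = V (n, xt, xb) := by
  have key : ∀ n xt xb, Vt (n, xt) - V (n, xt, xb) =
      γ * ∑ n', ∑ xt', ∑ xb', pN n (πt (n, xt)) xt n' * pXt xt xt' * pXb xb xb' *
        (Vt (n', xt') - V (n', xt', xb')) := by
    intro n xt xb
    have h : ∀ n' xt', pN n (πt (n, xt)) xt n' * pXt xt xt' * Vt (n', xt') =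
        ∑ xb', pN n (πt (n, xt)) xt n' * pXt xt xt' * pXb xb xb' * Vt (n', xt') := by
      intro n' xt'
      rw [← Finset.sum_mul, ← Finset.mul_sum, hpXb1, mul_one]
    rw [hV, hVt]
    simp only [h, mul_sub, Finset.sum_sub_distrib]
    ring
  obtain ⟨⟨n₀, xt₀, xb₀⟩, hmax⟩ :=
    Finite.exists_max (fun s : N × Xt × Xb => |Vt (s.1, s.2.1) - V s|)
  have hmax' : ∀ n xt xb, |Vt (n, xt) - V (n, xt, xb)| ≤
      |Vt (n₀, xt₀) - V (n₀, xt₀, xb₀)| := fun n xt xb => hmax (n, xt, xb)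
  obtain ⟨M, hM⟩ : ∃ M, M = |Vt (n₀, xt₀) - V (n₀, xt₀, xb₀)| := ⟨_, rfl⟩
  rw [← hM] at hmax'
  have hle : M ≤ γ * M := by
    have hw : ∑ n', ∑ xt', ∑ xb', pN n₀ (πt (n₀, xt₀)) xt₀ n' * pXt xt₀ xt' * pXb xb₀ xb' * M
        = M := by
      simp only [← Finset.sum_mul, ← Finset.mul_sum, hpXb1, hpXt1, hpN1, mul_one, one_mul]
    calc M = γ * |∑ n', ∑ xt', ∑ xb', pN n₀ (πt (n₀, xt₀)) xt₀ n' * pXt xt₀ xt' *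
          pXb xb₀ xb' * (Vt (n', xt') - V (n', xt', xb'))| := by
            rw [hM, key, abs_mul, abs_of_nonneg hγ0]
      _ ≤ γ * M := by
        refine mul_le_mul_of_nonneg_left ?_ hγ0
        conv_rhs => rw [← hw]
        refine (Finset.abs_sum_le_sum_abs _ _).trans (Finset.sum_le_sum fun n' _ => ?_)
        refine (Finset.abs_sum_le_sum_abs _ _).trans (Finset.sum_le_sum fun xt' _ => ?_)
        refine (Finset.abs_sum_le_sum_abs _ _).trans (Finset.sum_le_sum fun xb' _ => ?_)
        have hp := mul_nonneg (mul_nonneg (hpN0 n₀ (πt (n₀, xt₀)) xt₀ n') (hpXt0 xt₀ xt'))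
          (hpXb0 xb₀ xb')
        rw [abs_mul, abs_of_nonneg hp]
        exact mul_le_mul_of_nonneg_left (hmax' n' xt' xb') hp
  have hM0 : M ≤ 0 := by nlinarith
  intro n xt xb
  exact sub_eq_zero.mp (abs_nonpos_iff.mp ((hmax' n xt xb).trans hM0))
end

section
/- Let M be a finite MDP with exogenous structure satisfying the three conditions of Theorem 1 (reward depends only on the reduced state; the full transition factorizes as pN(n'|n,a,x̃) · pX̃(x̃'|x̃) · pX̄(x̄'|x̄)). Suppose the reduced policy π̃ : N × X̃ → A is optimal for the reduced MDP, i.e., Ṽ_π̃ equals the unique fixed point Ṽ* of the reduced Bellman optimality operator. Then for every full state s = (n, x̃, x̄), Ṽ_π̃(n, x̃) = V*(s), where V* is the unique fixed point of the Bellman optimality operator of the full MDP; in particular, for every stationary policy π : S → A of the full MDP and every state s, V_π(s) ≤ Ṽ_π̃(n, x̃). -/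
/-- Comparison principle: a subsolution (for some action) lies below a supersolution (for all). -/
theorem bellman_comparison
    {N Xt Xb A : Type} [Fintype N] [Fintype Xt] [Fintype Xb]
    [Nonempty N] [Nonempty Xt] [Nonempty Xb]
    (pN : N → A → Xt → N → ℝ) (pXt : Xt → Xt → ℝ) (pXb : Xb → Xb → ℝ)
    (Rt : N × Xt → A → ℝ) (γ : ℝ)
    (hpN0 : ∀ n a xt n', 0 ≤ pN n a xt n')
    (hpN1 : ∀ n a xt, ∑ n', pN n a xt n' = 1)
    (hpXt0 : ∀ xt xt', 0 ≤ pXt xt xt')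
    (hpXt1 : ∀ xt, ∑ xt', pXt xt xt' = 1)
    (hpXb0 : ∀ xb xb', 0 ≤ pXb xb xb')
    (hpXb1 : ∀ xb, ∑ xb', pXb xb xb' = 1)
    (hγ0 : 0 ≤ γ) (hγ1 : γ < 1)
    (V U : N × Xt × Xb → ℝ)
    (hV : ∀ n xt xb, ∃ a, V (n, xt, xb) ≤ Rt (n, xt) a + γ * ∑ n', ∑ xt', ∑ xb',
          pN n a xt n' * pXt xt xt' * pXb xb xb' * V (n', xt', xb'))
    (hU : ∀ n xt xb a, Rt (n, xt) a + γ * ∑ n', ∑ xt', ∑ xb',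
          pN n a xt n' * pXt xt xt' * pXb xb xb' * U (n', xt', xb') ≤ U (n, xt, xb)) :
    ∀ s, V s ≤ U s := by
  obtain ⟨⟨n, xt, xb⟩, hs⟩ := Finite.exists_max (fun s => V s - U s)
  obtain ⟨a, ha⟩ := hV n xt xb
  have hu := hU n xt xb a
  have key : ∑ n', ∑ xt', ∑ xb', pN n a xt n' * pXt xt xt' * pXb xb xb' * V (n', xt', xb') ≤
      ∑ n', ∑ xt', ∑ xb', pN n a xt n' * pXt xt xt' * pXb xb xb' * U (n', xt', xb')
        + (V (n, xt, xb) - U (n, xt, xb)) := by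
    have e : V (n, xt, xb) - U (n, xt, xb) = ∑ n', ∑ xt', ∑ xb',
        pN n a xt n' * pXt xt xt' * pXb xb xb' * (V (n, xt, xb) - U (n, xt, xb)) := by
      simp only [← Finset.sum_mul, ← Finset.mul_sum, hpXb1, hpXt1, hpN1, mul_one, one_mul]
    rw [e]
    simp only [← Finset.sum_add_distrib]
    refine Finset.sum_le_sum fun n' _ => Finset.sum_le_sum fun xt' _ =>
      Finset.sum_le_sum fun xb' _ => ?_
    rw [← mul_add]
    refine mul_le_mul_of_nonneg_left ?_
      (mul_nonneg (mul_nonneg (hpN0 _ _ _ _) (hpXt0 _ _)) (hpXb0 _ _))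
    have := hs (n', xt', xb')
    linarith
  have k2 := mul_le_mul_of_nonneg_left key hγ0
  rw [mul_add] at k2
  have hd : V (n, xt, xb) - U (n, xt, xb) ≤ 0 := by
    by_contra! hc
    nlinarith
  intro s
  have := hs s
  linarith

/-- Theorem 1 (optimality): if the reduced policy is optimal for the reduced MDP,
then its reduced value function equals the optimal value function of the full MDP,
and in particular it dominates the value of every stationary policy of the full MDP. -/
theorem reduced_optimal_policy_is_full_optimal
    {N Xt Xb A : Type} [Fintype N] [Fintype Xt] [Fintype Xb] [Fintype A]
    [Nonempty N] [Nonempty Xt] [Nonempty Xb] [Nonempty A]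
    (pN : N → A → Xt → N → ℝ) (pXt : Xt → Xt → ℝ) (pXb : Xb → Xb → ℝ)
    (Rt : N × Xt → A → ℝ) (γ : ℝ)
    (hpN0 : ∀ n a xt n', 0 ≤ pN n a xt n')
    (hpN1 : ∀ n a xt, ∑ n', pN n a xt n' = 1)
    (hpXt0 : ∀ xt xt', 0 ≤ pXt xt xt')
    (hpXt1 : ∀ xt, ∑ xt', pXt xt xt' = 1)
    (hpXb0 : ∀ xb xb', 0 ≤ pXb xb xb')
    (hpXb1 : ∀ xb, ∑ xb', pXb xb xb' = 1)
    (hγ0 : 0 ≤ γ) (hγ1 : γ < 1)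
    (πt : N × Xt → A)
    (Vtπ : N × Xt → ℝ) (Vtstar : N × Xt → ℝ) (Vstar : N × Xt × Xb → ℝ)
    -- Vtπ is the value function of πt in the reduced MDP:
    (hVtπ : ∀ n xt, Vtπ (n, xt) =
      Rt (n, xt) (πt (n, xt)) +
        γ * ∑ n', ∑ xt', pN n (πt (n, xt)) xt n' * pXt xt xt' * Vtπ (n', xt'))
    -- Vtstar is the (unique) fixed point of the reduced Bellman optimality operator:
    (hVtstar : ∀ n xt, Vtstar (n, xt) =
      Finset.univ.sup' Finset.univ_nonempty (fun a : A =>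
        Rt (n, xt) a + γ * ∑ n', ∑ xt', pN n a xt n' * pXt xt xt' * Vtstar (n', xt')))
    -- πt is optimal for the reduced MDP:
    (hopt : ∀ n xt, Vtπ (n, xt) = Vtstar (n, xt))
    -- Vstar is the (unique) fixed point of the full Bellman optimality operator:
    (hVstar : ∀ n xt xb, Vstar (n, xt, xb) =
      Finset.univ.sup' Finset.univ_nonempty (fun a : A =>
        Rt (n, xt) a + γ * ∑ n', ∑ xt', ∑ xb',
          pN n a xt n' * pXt xt xt' * pXb xb xb' * Vstar (n', xt', xb'))) :
    (∀ n xt xb, Vtπ (n, xt) = Vstar (n, xt, xb)) ∧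
    (∀ (π : N × Xt × Xb → A) (Vπ : N × Xt × Xb → ℝ),
      (∀ n xt xb, Vπ (n, xt, xb) =
        Rt (n, xt) (π (n, xt, xb)) +
          γ * ∑ n', ∑ xt', ∑ xb',
            pN n (π (n, xt, xb)) xt n' * pXt xt xt' * pXb xb xb' * Vπ (n', xt', xb')) →
      ∀ n xt xb, Vπ (n, xt, xb) ≤ Vtπ (n, xt)) := by
  have lift : ∀ n a xt xb, ∑ n', ∑ xt', ∑ xb',
      pN n a xt n' * pXt xt xt' * pXb xb xb' * Vtstar (n', xt') =
      ∑ n', ∑ xt', pN n a xt n' * pXt xt xt' * Vtstar (n', xt') := by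
    intro n a xt xb
    refine Finset.sum_congr rfl fun n' _ => Finset.sum_congr rfl fun xt' _ => ?_
    rw [← Finset.sum_mul, ← Finset.mul_sum, hpXb1, mul_one]
  have cmp := bellman_comparison pN pXt pXb Rt γ hpN0 hpN1 hpXt0 hpXt1 hpXb0 hpXb1 hγ0 hγ1
  have hUsup : ∀ n xt (xb : Xb) a, Rt (n, xt) a + γ * ∑ n', ∑ xt', ∑ xb',
      pN n a xt n' * pXt xt xt' * pXb xb xb' * Vtstar (n', xt') ≤ Vtstar (n, xt) := by
    intro n xt xb a
    rw [lift, hVtstar n xt]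
    exact Finset.le_sup' (fun a : A =>
      Rt (n, xt) a + γ * ∑ n', ∑ xt', pN n a xt n' * pXt xt xt' * Vtstar (n', xt'))
      (Finset.mem_univ a)
  refine ⟨fun n xt xb => ?_, fun π Vπ hπ n xt xb => ?_⟩
  · rw [hopt]
    apply le_antisymm
    · refine cmp (fun s => Vtstar (s.1, s.2.1)) Vstar ?_ ?_ (n, xt, xb)
      · intro n xt xb
        obtain ⟨a, -, ha⟩ := Finset.exists_mem_eq_sup' Finset.univ_nonempty (fun a : A =>
          Rt (n, xt) a + γ * ∑ n', ∑ xt', pN n a xt n' * pXt xt xt' * Vtstar (n', xt'))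
        refine ⟨a, ?_⟩
        simp only [lift]
        rw [← ha, ← hVtstar]
      · intro n xt xb a
        rw [hVstar n xt xb]
        exact Finset.le_sup' (fun a : A => Rt (n, xt) a + γ * ∑ n', ∑ xt', ∑ xb',
          pN n a xt n' * pXt xt xt' * pXb xb xb' * Vstar (n', xt', xb')) (Finset.mem_univ a)
    · refine cmp Vstar (fun s => Vtstar (s.1, s.2.1)) ?_ hUsup (n, xt, xb)
      intro n xt xb
      obtain ⟨a, -, ha⟩ := Finset.exists_mem_eq_sup' Finset.univ_nonempty (fun a : A =>
        Rt (n, xt) a + γ * ∑ n', ∑ xt', ∑ xb',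
          pN n a xt n' * pXt xt xt' * pXb xb xb' * Vstar (n', xt', xb'))
      exact ⟨a, by rw [← ha, ← hVstar]⟩
  · rw [hopt]
    exact cmp Vπ (fun s => Vtstar (s.1, s.2.1)) (fun n xt xb => ⟨_, (hπ n xt xb).le⟩) hUsup
      (n, xt, xb)
end

section
/- Value-iteration induction from the proof of Theorem 1: Let M be a finite MDP with exogenous structure satisfying the three conditions of Theorem 1, and let π̃ : N × X̃ → A be a reduced policy. Define iterates V⁰ ≡ 0 on S and V^{k+1}(s) = R̃((n,x̃), π̃(n,x̃)) + γ Σ_{s'} P(s'|s, π̃(n,x̃)) V^k(s'), and reduced iterates Ṽ⁰ ≡ 0 on N × X̃ and Ṽ^{k+1}(n,x̃) = R̃((n,x̃), π̃(n,x̃)) + γ Σ_{(n',x̃')} P̃((n',x̃')|(n,x̃), π̃(n,x̃)) Ṽ^k(n',x̃'). Then for every k ∈ ℕ and every state (n, x̃, x̄), V^k(n, x̃, x̄) = Ṽ^k(n, x̃). -/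
/-- Value-iteration induction from the proof of Theorem 1: the full and reduced
policy-evaluation iterates agree at every iteration. -/
theorem value_iterates_agree
    {N Xt Xb A : Type} [Fintype N] [Fintype Xt] [Fintype Xb] [Fintype A]
    [Nonempty N] [Nonempty Xt] [Nonempty Xb] [Nonempty A]
    (pN : N → A → Xt → N → ℝ) (pXt : Xt → Xt → ℝ) (pXb : Xb → Xb → ℝ)
    (Rt : N × Xt → A → ℝ) (γ : ℝ)
    (hpN0 : ∀ n a xt n', 0 ≤ pN n a xt n')
    (hpN1 : ∀ n a xt, ∑ n', pN n a xt n' = 1)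
    (hpXt0 : ∀ xt xt', 0 ≤ pXt xt xt')
    (hpXt1 : ∀ xt, ∑ xt', pXt xt xt' = 1)
    (hpXb0 : ∀ xb xb', 0 ≤ pXb xb xb')
    (hpXb1 : ∀ xb, ∑ xb', pXb xb xb' = 1)
    (πt : N × Xt → A)
    (V : ℕ → N × Xt × Xb → ℝ) (Vt : ℕ → N × Xt → ℝ)
    (hV0 : ∀ s, V 0 s = 0)
    (hVsucc : ∀ k n xt xb, V (k + 1) (n, xt, xb) =
      Rt (n, xt) (πt (n, xt)) +
        γ * ∑ n', ∑ xt', ∑ xb',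
          pN n (πt (n, xt)) xt n' * pXt xt xt' * pXb xb xb' * V k (n', xt', xb'))
    (hVt0 : ∀ st, Vt 0 st = 0)
    (hVtsucc : ∀ k n xt, Vt (k + 1) (n, xt) =
      Rt (n, xt) (πt (n, xt)) +
        γ * ∑ n', ∑ xt', pN n (πt (n, xt)) xt n' * pXt xt xt' * Vt k (n', xt')) :
    ∀ k n xt xb, V k (n, xt, xb) = Vt k (n, xt) := by
  intro k
  induction k with
  | zero =>
    intro n xt xb
    rw [hV0, hVt0]
  | succ k ih =>
    intro n xt xb
    rw [hVsucc, hVtsucc]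
    congr 2
    refine Finset.sum_congr rfl fun n' _ => Finset.sum_congr rfl fun xt' _ => ?_
    simp only [ih]
    rw [← Finset.sum_mul, ← Finset.mul_sum, hpXb1, mul_one]
end

section
/- Reduced-state dependence of the optimal value function: let M be a finite MDP with exogenous structure satisfying the three conditions of Theorem 1 (reward R̃ depends only on the reduced state (n, x̃); the full transition factorizes as P((n',x̃',x̄') | (n,x̃,x̄), a) = pN(n'|n,a,x̃) · pX̃(x̃'|x̃) · pX̄(x̄'|x̄)), with discount 0 ≤ γ < 1. Then the unique fixed point V* of the Bellman optimality operator of the full MDP depends only on the reduced state: for all n ∈ N, x̃ ∈ X̃, and x̄, x̄' ∈ X̄, V*(n, x̃, x̄) = V*(n, x̃, x̄'). -/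
/-- Reduced-state dependence of the optimal value function: under the three
exogeneity conditions of Theorem 1, the fixed point of the full Bellman
optimality operator does not depend on the unmasked exogenous component. -/
theorem optimal_value_depends_only_on_reduced_state
    {N Xt Xb A : Type} [Fintype N] [Fintype Xt] [Fintype Xb] [Fintype A]
    [Nonempty N] [Nonempty Xt] [Nonempty Xb] [Nonempty A]
    (pN : N → A → Xt → N → ℝ) (pXt : Xt → Xt → ℝ) (pXb : Xb → Xb → ℝ)
    (Rt : N × Xt → A → ℝ) (γ : ℝ)
    (hpN0 : ∀ n a xt n', 0 ≤ pN n a xt n')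
    (hpN1 : ∀ n a xt, ∑ n', pN n a xt n' = 1)
    (hpXt0 : ∀ xt xt', 0 ≤ pXt xt xt')
    (hpXt1 : ∀ xt, ∑ xt', pXt xt xt' = 1)
    (hpXb0 : ∀ xb xb', 0 ≤ pXb xb xb')
    (hpXb1 : ∀ xb, ∑ xb', pXb xb xb' = 1)
    (hγ0 : 0 ≤ γ) (hγ1 : γ < 1)
    (Vstar : N × Xt × Xb → ℝ)
    (hVstar : ∀ n xt xb, Vstar (n, xt, xb) =
      Finset.univ.sup' Finset.univ_nonempty (fun a : A =>
        Rt (n, xt) a + γ * ∑ n', ∑ xt', ∑ xb',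
          pN n a xt n' * pXt xt xt' * pXb xb xb' * Vstar (n', xt', xb'))) :
    ∀ (n : N) (xt : Xt) (xb xb' : Xb), Vstar (n, xt, xb) = Vstar (n, xt, xb') := by
  obtain ⟨q0, hq0⟩ := Finite.exists_max
    (fun q : N × Xt × Xb × Xb => Vstar (q.1, q.2.1, q.2.2.1) - Vstar (q.1, q.2.1, q.2.2.2))
  obtain ⟨D, hD⟩ : ∃ D, D = Vstar (q0.1, q0.2.1, q0.2.2.1) - Vstar (q0.1, q0.2.1, q0.2.2.2) :=
    ⟨_, rfl⟩
  have hmax : ∀ n xt xb xb', Vstar (n, xt, xb) - Vstar (n, xt, xb') ≤ D := by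
    intro n xt xb xb'
    rw [hD]
    exact hq0 (n, xt, xb, xb')
  have havg : ∀ n xt xb xb', ∑ c, pXb xb c * Vstar (n, xt, c) ≤
      (∑ c, pXb xb' c * Vstar (n, xt, c)) + D := by
    intro n xt xb xb'
    obtain ⟨c0, hc0⟩ := Finite.exists_min (fun c => Vstar (n, xt, c))
    have h1 : ∑ c, pXb xb c * Vstar (n, xt, c) ≤ ∑ c, pXb xb c * (Vstar (n, xt, c0) + D) :=
      Finset.sum_le_sum fun c _ => mul_le_mul_of_nonneg_left
        (by linarith [hmax n xt c c0]) (hpXb0 _ _)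
    have h2 : ∑ c, pXb xb' c * Vstar (n, xt, c0) ≤ ∑ c, pXb xb' c * Vstar (n, xt, c) :=
      Finset.sum_le_sum fun c _ => mul_le_mul_of_nonneg_left (hc0 c) (hpXb0 _ _)
    rw [← Finset.sum_mul, hpXb1, one_mul] at h1 h2
    linarith
  have hfull : ∀ n a xt xb xb',
      ∑ n', ∑ xt', ∑ c, pN n a xt n' * pXt xt xt' * pXb xb c * Vstar (n', xt', c) ≤
      (∑ n', ∑ xt', ∑ c, pN n a xt n' * pXt xt xt' * pXb xb' c * Vstar (n', xt', c)) + D := by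
    intro n a xt xb xb'
    have hone : ∑ n', ∑ xt', pN n a xt n' * pXt xt xt' * D = D := by
      simp only [← Finset.sum_mul, ← Finset.mul_sum, hpXt1, hpN1, mul_one, one_mul]
    calc _ ≤ ∑ n', ∑ xt', ((∑ c, pN n a xt n' * pXt xt xt' * pXb xb' c * Vstar (n', xt', c))
            + pN n a xt n' * pXt xt xt' * D) := by
          refine Finset.sum_le_sum fun n' _ => Finset.sum_le_sum fun xt' _ => ?_
          have h := mul_le_mul_of_nonneg_left (havg n' xt' xb xb')
            (mul_nonneg (hpN0 n a xt n') (hpXt0 xt xt'))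
          rw [mul_add, Finset.mul_sum, Finset.mul_sum] at h
          simpa only [mul_assoc] using h
      _ = _ := by simp only [Finset.sum_add_distrib, hone]
  have hcontr : ∀ n xt xb xb', Vstar (n, xt, xb) ≤ Vstar (n, xt, xb') + γ * D := by
    intro n xt xb xb'
    rw [hVstar n xt xb]
    refine Finset.sup'_le _ _ fun a _ => ?_
    have h1 := mul_le_mul_of_nonneg_left (hfull n a xt xb xb') hγ0
    have h2 := Finset.le_sup' (fun a : A =>
        Rt (n, xt) a + γ * ∑ n', ∑ xt', ∑ c,
          pN n a xt n' * pXt xt xt' * pXb xb' c * Vstar (n', xt', c)) (Finset.mem_univ a)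
    rw [← hVstar n xt xb'] at h2
    rw [mul_add] at h1
    linarith
  have hD0 : D ≤ 0 := by
    have h := hcontr q0.1 q0.2.1 q0.2.2.1 q0.2.2.2
    by_contra! hpos
    nlinarith
  intro n xt xb xb'
  linarith [hmax n xt xb xb', hmax n xt xb' xb]
end

section
/- Equality of optimal values of the reduced and full MDPs: let M be a finite MDP with exogenous structure satisfying the three conditions of Theorem 1 (reward R̃ depends only on the reduced state; the full transition factorizes as pN(n'|n,a,x̃) · pX̃(x̃'|x̃) · pX̄(x̄'|x̄)), with discount 0 ≤ γ < 1. Let V* be the unique fixed point of the Bellman optimality operator of the full MDP and Ṽ* the unique fixed point of the Bellman optimality operator of the reduced MDP (with state space N × X̃ and transition P̃((n',x̃')|(n,x̃),a) = pN(n'|n,a,x̃) · pX̃(x̃'|x̃)). Then for all n ∈ N, x̃ ∈ X̃, x̄ ∈ X̄, Ṽ*(n, x̃) = V*(n, x̃, x̄). -/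
theorem bellman_fixed_le {S A : Type} [Fintype S] [Fintype A] [Nonempty S] [Nonempty A]
    (P : S → A → S → ℝ) (R : S → A → ℝ) (γ : ℝ)
    (hP0 : ∀ s a t, 0 ≤ P s a t) (hP1 : ∀ s a, ∑ t, P s a t = 1)
    (hγ0 : 0 ≤ γ) (hγ1 : γ < 1) (V W : S → ℝ)
    (hV : ∀ s, V s = Finset.univ.sup' Finset.univ_nonempty
      (fun a : A => R s a + γ * ∑ t, P s a t * V t))
    (hW : ∀ s, W s = Finset.univ.sup' Finset.univ_nonempty
      (fun a : A => R s a + γ * ∑ t, P s a t * W t)) (s : S) : V s ≤ W s := by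
  obtain ⟨m, hm⟩ := Finite.exists_max (fun s => V s - W s)
  have key : V m ≤ W m + γ * (V m - W m) := by
    conv_lhs => rw [hV m]
    apply Finset.sup'_le
    intro a _
    have h1 : R m a + γ * ∑ t, P m a t * W t ≤ W m := by
      conv_rhs => rw [hW m]
      exact Finset.le_sup' (fun a : A => R m a + γ * ∑ t, P m a t * W t) (Finset.mem_univ a)
    have h2 : ∑ t, P m a t * V t ≤ ∑ t, P m a t * W t + (V m - W m) := by
      calc ∑ t, P m a t * V t ≤ ∑ t, (P m a t * W t + P m a t * (V m - W m)) := by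
            apply Finset.sum_le_sum
            intro t _
            rw [← mul_add]
            exact mul_le_mul_of_nonneg_left (by linarith [hm t]) (hP0 m a t)
        _ = _ := by rw [Finset.sum_add_distrib, ← Finset.sum_mul, hP1, one_mul]
    have h3 := mul_le_mul_of_nonneg_left h2 hγ0
    rw [mul_add] at h3
    linarith
  have h4 := hm s
  nlinarith

/-- Equality of optimal values of the reduced and full MDPs: under the three
exogeneity conditions of Theorem 1, the fixed point of the reduced Bellman
optimality operator agrees with the fixed point of the full Bellman optimality
operator at every full state. -/
theorem reduced_optimal_value_eq_full_optimal_value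
    {N Xt Xb A : Type} [Fintype N] [Fintype Xt] [Fintype Xb] [Fintype A]
    [Nonempty N] [Nonempty Xt] [Nonempty Xb] [Nonempty A]
    (pN : N → A → Xt → N → ℝ) (pXt : Xt → Xt → ℝ) (pXb : Xb → Xb → ℝ)
    (Rt : N × Xt → A → ℝ) (γ : ℝ)
    (hpN0 : ∀ n a xt n', 0 ≤ pN n a xt n')
    (hpN1 : ∀ n a xt, ∑ n', pN n a xt n' = 1)
    (hpXt0 : ∀ xt xt', 0 ≤ pXt xt xt')
    (hpXt1 : ∀ xt, ∑ xt', pXt xt xt' = 1)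
    (hpXb0 : ∀ xb xb', 0 ≤ pXb xb xb')
    (hpXb1 : ∀ xb, ∑ xb', pXb xb xb' = 1)
    (hγ0 : 0 ≤ γ) (hγ1 : γ < 1)
    (Vstar : N × Xt × Xb → ℝ) (Vtstar : N × Xt → ℝ)
    (hVstar : ∀ n xt xb, Vstar (n, xt, xb) =
      Finset.univ.sup' Finset.univ_nonempty (fun a : A =>
        Rt (n, xt) a + γ * ∑ n', ∑ xt', ∑ xb',
          pN n a xt n' * pXt xt xt' * pXb xb xb' * Vstar (n', xt', xb')))
    (hVtstar : ∀ n xt, Vtstar (n, xt) =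
      Finset.univ.sup' Finset.univ_nonempty (fun a : A =>
        Rt (n, xt) a + γ * ∑ n', ∑ xt',
          pN n a xt n' * pXt xt xt' * Vtstar (n', xt'))) :
    ∀ (n : N) (xt : Xt) (xb : Xb), Vtstar (n, xt) = Vstar (n, xt, xb) := by
  have hP0 : ∀ (s : N × Xt × Xb) (a : A) (t : N × Xt × Xb),
      0 ≤ pN s.1 a s.2.1 t.1 * pXt s.2.1 t.2.1 * pXb s.2.2 t.2.2 := fun s a t =>
    mul_nonneg (mul_nonneg (hpN0 _ _ _ _) (hpXt0 _ _)) (hpXb0 _ _)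
  have hP1 : ∀ (s : N × Xt × Xb) (a : A),
      ∑ t : N × Xt × Xb, pN s.1 a s.2.1 t.1 * pXt s.2.1 t.2.1 * pXb s.2.2 t.2.2 = 1 := by
    intro s a
    simp only [Fintype.sum_prod_type, ← Finset.mul_sum, hpXb1, hpXt1, hpN1, mul_one]
  have hV : ∀ s : N × Xt × Xb, Vstar s = Finset.univ.sup' Finset.univ_nonempty
      (fun a : A => Rt (s.1, s.2.1) a + γ * ∑ t : N × Xt × Xb,
        pN s.1 a s.2.1 t.1 * pXt s.2.1 t.2.1 * pXb s.2.2 t.2.2 * Vstar t) := by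
    rintro ⟨n, xt, xb⟩
    simp only [Fintype.sum_prod_type]
    exact hVstar n xt xb
  have hW : ∀ s : N × Xt × Xb, Vtstar (s.1, s.2.1) = Finset.univ.sup' Finset.univ_nonempty
      (fun a : A => Rt (s.1, s.2.1) a + γ * ∑ t : N × Xt × Xb,
        pN s.1 a s.2.1 t.1 * pXt s.2.1 t.2.1 * pXb s.2.2 t.2.2 * Vtstar (t.1, t.2.1)) := by
    rintro ⟨n, xt, xb⟩
    simp only [Fintype.sum_prod_type, ← Finset.sum_mul, ← Finset.mul_sum, hpXb1, mul_one]
    exact hVtstar n xt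
  intro n xt xb
  exact le_antisymm
    (bellman_fixed_le _ (fun s a => Rt (s.1, s.2.1) a) γ hP0 hP1 hγ0 hγ1
      (fun s => Vtstar (s.1, s.2.1)) Vstar hW hV (n, xt, xb))
    (bellman_fixed_le _ (fun s a => Rt (s.1, s.2.1) a) γ hP0 hP1 hγ0 hγ1
      Vstar (fun s => Vtstar (s.1, s.2.1)) hV hW (n, xt, xb))
end
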